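/- Let ℋ be a positive real-analytic function on an open neighborhood O of the origin of ℝ³, let A: ℝ → ℝ∖{0} be a 2π-periodic real-analytic nowhere-vanishing function, and let ψ: ℝ × (−R,R) → O be a real-analytic map, 2π-periodic in u, satisfying ψ_uu + ψ_vv = 2 ℋ(ψ) ψ_u ×_L ψ_v, ψ(u,0) = 0 and ∂_vψ(u,0) = A(u)(cos u, −sin u, 1) for all u ∈ ℝ, the conformality conditions ⟨ψ_u,ψ_u⟩_L = ⟨ψ_v,ψ_v⟩_L and ⟨ψ_u,ψ_v⟩_L = 0 everywhere, and (on ℝ × (0,R)) the spacelike-graph conditions ∂_uψ₁ ∂_vψ₂ − ∂_vψ₁ ∂_uψ₂ > 0 and ⟨ψ_u,ψ_u⟩_L > 0. Then there exist R' ∈ (0,R] and δ > 0 such that the map (u mod 2π, v) ↦ (ψ₁(u,v), ψ₂(u,v)) is a diffeomorphism from (ℝ/2πℤ) × (0,R') onto a punctured neighborhood of the origin of ℝ²; consequently there is a function z defined on that punctured neighborhood with z_x² + z_y² < 1 and ψ₃(u,v) = z(ψ₁(u,v), ψ₂(u,v)), i.e., ψ(ℝ × (0,R')) is a spacelike graph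 over a punctured disk. -/

import Mathlib

noncomputable section

open Real Set Metric Filter MeasureTheory

/-- Points of Minkowski 3-space, as nested pairs. -/
abbrev R3 : Type := ℝ × ℝ × ℝ

/-- The Lorentzian inner product `⟨a,b⟩_L = a₁b₁ + a₂b₂ − a₃b₃` of Minkowski 3-space. -/
def lor (a b : R3) : ℝ := a.1 * b.1 + a.2.1 * b.2.1 - a.2.2 * b.2.2

/-- The Lorentzian cross product
`a ×_L b = (a₃b₂ − a₂b₃, a₁b₃ − a₃b₁, a₁b₂ − a₂b₁)`. -/
def lcross (a b : R3) : R3 :=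
  (a.2.2 * b.2.1 - a.2.1 * b.2.2, a.1 * b.2.2 - a.2.2 * b.1, a.1 * b.2.1 - a.2.1 * b.1)

/-- Partial derivative with respect to the first variable. -/
def pd1 {E : Type*} [NormedAddCommGroup E] [NormedSpace ℝ E]
    (f : ℝ × ℝ → E) (p : ℝ × ℝ) : E := fderiv ℝ f p (1, 0)

/-- Partial derivative with respect to the second variable. -/
def pd2 {E : Type*} [NormedAddCommGroup E] [NormedSpace ℝ E]
    (f : ℝ × ℝ → E) (p : ℝ × ℝ) : E := fderiv ℝ f p (0, 1)

def zx (z : ℝ × ℝ → ℝ) : ℝ × ℝ → ℝ := pd1 z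
def zy (z : ℝ × ℝ → ℝ) : ℝ × ℝ → ℝ := pd2 z
def zxx (z : ℝ × ℝ → ℝ) : ℝ × ℝ → ℝ := pd1 (zx z)
def zxy (z : ℝ × ℝ → ℝ) : ℝ × ℝ → ℝ := pd2 (zx z)
def zyy (z : ℝ × ℝ → ℝ) : ℝ × ℝ → ℝ := pd2 (zy z)

/-- Hessian determinant `z_xx z_yy − z_xy²`. -/
def hessDet (z : ℝ × ℝ → ℝ) (p : ℝ × ℝ) : ℝ := zxx z p * zyy z p - (zxy z p) ^ 2

/-- The punctured disk `{(x,y) : 0 < (x−x₀)² + (y−y₀)² < ρ²}`. -/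
def PDisk (x₀ y₀ ρ : ℝ) : Set (ℝ × ℝ) :=
  {p | 0 < (p.1 - x₀) ^ 2 + (p.2 - y₀) ^ 2 ∧ (p.1 - x₀) ^ 2 + (p.2 - y₀) ^ 2 < ρ ^ 2}

/-- `z` is an elliptic solution of the prescribed mean curvature equation for `H` on `U`,
with graph contained in `O`. -/
def IsEllSol (H : R3 → ℝ) (O : Set R3) (U : Set (ℝ × ℝ)) (z : ℝ × ℝ → ℝ) : Prop :=
  ContDiffOn ℝ 2 z U ∧
  (∀ p ∈ U, ((p.1, p.2, z p) : R3) ∈ O) ∧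
  (∀ p ∈ U, (zx z p) ^ 2 + (zy z p) ^ 2 < 1) ∧
  (∀ p ∈ U,
    (1 - (zy z p) ^ 2) * zxx z p + 2 * zx z p * zy z p * zxy z p
        + (1 - (zx z p) ^ 2) * zyy z p
      = 2 * H (p.1, p.2, z p) * (1 - (zx z p) ^ 2 - (zy z p) ^ 2) ^ ((3 : ℝ) / 2))

/-- The isolated singularity of `z` at `(x₀,y₀)` is removable: some `C²` function on a full
disk centered at `(x₀,y₀)` agrees with `z` on a punctured neighborhood. -/
def RemovableSing (x₀ y₀ : ℝ) (z : ℝ × ℝ → ℝ) : Prop :=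
  ∃ ε > 0, ∃ Z : ℝ × ℝ → ℝ,
    ContDiffOn ℝ 2 Z (ball ((x₀, y₀) : ℝ × ℝ) ε) ∧
    ∀ p ∈ ball ((x₀, y₀) : ℝ × ℝ) ε, p ≠ (x₀, y₀) → Z p = z p

/-- `H` is of class `C^{k,α}` on `O`: it is `C^k` and its `k`-th derivative is locally
`α`-Hölder on `O`. -/
def IsCkalpha (k : ℕ) (α : NNReal) (H : R3 → ℝ) (O : Set R3) : Prop :=
  ContDiffOn ℝ k H O ∧
  ∀ p ∈ O, ∃ ε > 0, ∃ C : NNReal,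
    HolderOnWith C α (iteratedFDeriv ℝ k H) (ball p ε ∩ O)

/-- The open strip `ℝ × (0,R)`. -/
def Strip (R : ℝ) : Set (ℝ × ℝ) := {p | 0 < p.2 ∧ p.2 < R}

/-- The open strip `ℝ × (−R,R)`. -/
def Strip2 (R : ℝ) : Set (ℝ × ℝ) := {p | -R < p.2 ∧ p.2 < R}

/-- The half-open strip `ℝ × [0,R)`. -/
def StripCl (R : ℝ) : Set (ℝ × ℝ) := {p | 0 ≤ p.2 ∧ p.2 < R}

/-- First two components of `ψ`: the planar projection `Π = (ψ₁, ψ₂)`. -/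
def Pi2 (ψ : ℝ × ℝ → R3) (p : ℝ × ℝ) : ℝ × ℝ := ((ψ p).1, (ψ p).2.1)

def comp1 (ψ : ℝ × ℝ → R3) : ℝ × ℝ → ℝ := fun p => (ψ p).1
def comp2 (ψ : ℝ × ℝ → R3) : ℝ × ℝ → ℝ := fun p => (ψ p).2.1
def comp3 (ψ : ℝ × ℝ → R3) : ℝ × ℝ → ℝ := fun p => (ψ p).2.2

/-- `ψ : ℝ × (0,R) → ℝ³` is a conformal parametrization of the graph of `z` near the
singularity `(x₀,y₀)`: it is 2π-periodic in `u`, its planar projection induces a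
diffeomorphism with positive Jacobian from `(ℝ/2πℤ) × (0,R)` onto a punctured
neighborhood `W ⊆ Ω` of `(x₀,y₀)`, its third component is `z` of the first two, and the
conformality conditions hold. -/
def IsConfParam (z : ℝ × ℝ → ℝ) (Ω : Set (ℝ × ℝ)) (x₀ y₀ R : ℝ)
    (ψ : ℝ × ℝ → R3) : Prop :=
  0 < R ∧
  ContDiffOn ℝ 1 ψ (Strip R) ∧
  (∀ u v : ℝ, ψ (u + 2 * π, v) = ψ (u, v)) ∧
  (∃ W : Set (ℝ × ℝ), W ⊆ Ω ∧ ((x₀, y₀) : ℝ × ℝ) ∉ W ∧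
      insert ((x₀, y₀) : ℝ × ℝ) W ∈ nhds ((x₀, y₀) : ℝ × ℝ) ∧
      Pi2 ψ '' Strip R = W) ∧
  (∀ p ∈ Strip R, ∀ q ∈ Strip R, Pi2 ψ p = Pi2 ψ q →
      p.2 = q.2 ∧ ∃ n : ℤ, p.1 - q.1 = 2 * π * n) ∧
  (∀ p ∈ Strip R,
      0 < pd1 (comp1 ψ) p * pd2 (comp2 ψ) p - pd2 (comp1 ψ) p * pd1 (comp2 ψ) p) ∧
  (∀ p ∈ Strip R, comp3 ψ p = z (Pi2 ψ p)) ∧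
  (∀ p ∈ Strip R,
      lor (pd1 ψ p) (pd1 ψ p) = lor (pd2 ψ p) (pd2 ψ p) ∧
      0 < lor (pd1 ψ p) (pd1 ψ p) ∧
      lor (pd1 ψ p) (pd2 ψ p) = 0)

/-- `ψ` extends real-analytically across `v = 0`, with `ψ(u,0) = p₀` and
`∂_vψ(u,0) = A(u)(cos u, −sin u, 1)`. -/
def ExtAnal (ψ : ℝ × ℝ → R3) (R : ℝ) (p₀ : R3) (A : ℝ → ℝ) : Prop :=
  ∃ ε > 0, ∃ Ψ : ℝ × ℝ → R3,
    AnalyticOnNhd ℝ Ψ {p : ℝ × ℝ | -ε < p.2 ∧ p.2 < R} ∧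
    (∀ p ∈ Strip R, Ψ p = ψ p) ∧
    (∀ u : ℝ, Ψ (u, 0) = p₀) ∧
    (∀ u : ℝ, pd2 Ψ (u, 0) = (A u * Real.cos u, -(A u * Real.sin u), A u))

/-- The class `𝒜₂` of 2π-periodic, real-analytic, nowhere vanishing functions. -/
def MemA2 (A : ℝ → ℝ) : Prop :=
  AnalyticOnNhd ℝ A univ ∧ (∀ u : ℝ, A (u + 2 * π) = A u) ∧ ∀ u : ℝ, A u ≠ 0

/-- The class `𝒜₁`: elliptic solutions on a punctured disk of radius `ρ` centered at
`(x₀,y₀)`, extending continuously with value `z₀`, whose Hessian determinant is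
nonvanishing on a punctured neighborhood of `(x₀,y₀)`. -/
def MemA1 (H : R3 → ℝ) (O : Set R3) (x₀ y₀ z₀ ρ : ℝ) (z : ℝ × ℝ → ℝ) : Prop :=
  0 < ρ ∧ IsEllSol H O (PDisk x₀ y₀ ρ) z ∧
  Tendsto z (nhdsWithin ((x₀, y₀) : ℝ × ℝ) (PDisk x₀ y₀ ρ)) (nhds z₀) ∧
  ∃ ε : ℝ, 0 < ε ∧ ε ≤ ρ ∧ ∀ p ∈ PDisk x₀ y₀ ε, hessDet z p ≠ 0

/-- `z` corresponds to `A`: some conformal parametrization of the graph of `z` near the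
singularity extends real-analytically across `v = 0` with
`∂_vψ(u,0) = A(u)(cos u, −sin u, 1)`. -/
def Corr (z : ℝ × ℝ → ℝ) (x₀ y₀ z₀ ρ : ℝ) (A : ℝ → ℝ) : Prop :=
  ∃ R : ℝ, ∃ ψ : ℝ × ℝ → R3,
    IsConfParam z (PDisk x₀ y₀ ρ) x₀ y₀ R ψ ∧ ExtAnal ψ R ((x₀, y₀, z₀) : R3) A

/-- The induced (first fundamental form) metric of the graph of `z`,
`ds² = (1−z_x²)dx² − 2 z_x z_y dx dy + (1−z_y²)dy²`, as a bilinear form. -/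
def dsq (z : ℝ × ℝ → ℝ) (p : ℝ × ℝ) (ξ η : ℝ × ℝ) : ℝ :=
  (1 - (zx z p) ^ 2) * ξ.1 * η.1 - zx z p * zy z p * (ξ.1 * η.2 + ξ.2 * η.1)
    + (1 - (zy z p) ^ 2) * ξ.2 * η.2

/-- `(Ω, ds²)` is conformally equivalent to the planar domain `D`: there is a `C¹`
diffeomorphism `Φ : Ω → D` and a positive function `λ` with
`⟨DΦ(ξ), DΦ(η)⟩_euc = λ · ds²(ξ,η)`. -/
def ConfEquiv (z : ℝ × ℝ → ℝ) (Ω D : Set (ℝ × ℝ)) : Prop :=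
  ∃ (Φ : ℝ × ℝ → ℝ × ℝ) (Φinv : ℝ × ℝ → ℝ × ℝ) (lam : ℝ × ℝ → ℝ),
    ContDiffOn ℝ 1 Φ Ω ∧ ContDiffOn ℝ 1 Φinv D ∧
    (∀ p ∈ Ω, Φ p ∈ D ∧ Φinv (Φ p) = p) ∧
    (∀ q ∈ D, Φinv q ∈ Ω ∧ Φ (Φinv q) = q) ∧
    (∀ p ∈ Ω, 0 < lam p ∧
      ∀ ξ η : ℝ × ℝ, (fderiv ℝ Φ p ξ).1 * (fderiv ℝ Φ p η).1
          + (fderiv ℝ Φ p ξ).2 * (fderiv ℝ Φ p η).2 = lam p * dsq z p ξ η)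


section

open scoped Topology

theorem ContinuousLinearMap.apply_prod_eq (L : ℝ × ℝ →L[ℝ] ℝ) (x y : ℝ) :
    L (x, y) = L (1, 0) * x + L (0, 1) * y := by
  have : ((x, y) : ℝ × ℝ) = x • (1, 0) + y • (0, 1) := by simp
  rw [this, map_add, map_smul, map_smul, smul_eq_mul, smul_eq_mul]
  ring

/-- The average of `h` over the vertical segment from `(u, 0)` to `(u, v)`. -/
def vertAvg (h : ℝ × ℝ → ℝ) (p : ℝ × ℝ) : ℝ := ∫ t in (0 : ℝ)..1, h (p.1, t * p.2)

theorem mul_vertAvg_pd2 {f : ℝ × ℝ → ℝ} {R : ℝ} (hf : AnalyticOnNhd ℝ f (Strip2 R))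
    (h0 : ∀ u, f (u, 0) = 0) {p : ℝ × ℝ} (hp : p ∈ Strip2 R) :
    f p = p.2 * vertAvg (pd2 f) p := by
  obtain ⟨u, v⟩ := p
  obtain ⟨hp1, hp2⟩ := hp
  simp only at hp1 hp2
  have hmem : ∀ t ∈ uIcc (0 : ℝ) 1, (u, t * v) ∈ Strip2 R := by
    intro t ht
    rw [uIcc_of_le zero_le_one] at ht
    have : |t * v| ≤ |v| := by
      rw [abs_mul, abs_of_nonneg ht.1]
      exact mul_le_of_le_one_left (abs_nonneg v) ht.2
    exact abs_lt.1 (this.trans_lt (abs_lt.2 ⟨hp1, hp2⟩))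
  have hd : ∀ t ∈ uIcc (0 : ℝ) 1,
      HasDerivAt (fun s : ℝ => f (u, s * v)) (v * pd2 f (u, t * v)) t := by
    intro t ht
    have h1 := (hf _ (hmem t ht)).differentiableAt.hasFDerivAt
    have h2 : HasDerivAt (fun s : ℝ => (u, s * v)) (0, v) t :=
      (hasDerivAt_const t u).prodMk (by simpa using (hasDerivAt_id t).mul_const v)
    have h3 := h1.comp_hasDerivAt t h2
    have h4 : fderiv ℝ f (u, t * v) (0, v) = v * pd2 f (u, t * v) := by
      rw [ContinuousLinearMap.apply_prod_eq _ 0 v, pd2]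
      ring
    rw [h4] at h3
    exact h3
  have hc : ContinuousOn (fun t : ℝ => v * pd2 f (u, t * v)) (uIcc 0 1) := by
    intro t ht
    have h1 : ContinuousAt (fun q => fderiv ℝ f q) (u, t * v) :=
      (hf _ (hmem t ht)).fderiv.continuousAt
    have h2 : ContinuousAt (pd2 f) (u, t * v) := h1.clm_apply continuousAt_const
    have h3 : ContinuousAt (fun t : ℝ => (u, t * v)) t := by fun_prop
    exact (continuousAt_const.mul (ContinuousAt.comp (f := fun t : ℝ => (u, t * v))
      h2 h3)).continuousWithinAt
  have := intervalIntegral.integral_eq_sub_of_hasDerivAt hd hc.intervalIntegrable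
  rw [intervalIntegral.integral_const_mul] at this
  simp only [one_mul, zero_mul, h0, sub_zero] at this
  exact this.symm

theorem HasStrictFDerivAt.vertAvg {h : ℝ × ℝ → ℝ} {h' : ℝ × ℝ →L[ℝ] ℝ} {u : ℝ}
    (hh : HasStrictFDerivAt h h' (u, 0)) (hc : ∀ᶠ p in 𝓝 ((u, 0) : ℝ × ℝ), ContinuousAt h p) :
    HasStrictFDerivAt (vertAvg h)
      (h'.comp ((ContinuousLinearMap.fst ℝ ℝ ℝ).prod
        ((1 / 2 : ℝ) • ContinuousLinearMap.snd ℝ ℝ ℝ))) (u, 0) := by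
  refine .of_isLittleO (Asymptotics.isLittleO_iff.2 fun c hc0 => ?_)
  have h1 := Asymptotics.isLittleO_iff.1 hh.isLittleO hc0
  obtain ⟨ε₁, hε₁, H1⟩ := Metric.eventually_nhds_iff_ball.1 h1
  obtain ⟨ε₂, hε₂, H2⟩ := Metric.eventually_nhds_iff_ball.1 hc
  rw [Metric.eventually_nhds_iff_ball]
  refine ⟨min ε₁ ε₂, lt_min hε₁ hε₂, ?_⟩
  rintro ⟨⟨a, b⟩, ⟨a', b'⟩⟩ hp
  simp only [mem_ball, Prod.dist_eq, Real.dist_eq, sub_zero, max_lt_iff, lt_min_iff] at hp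
  obtain ⟨⟨⟨ha1, hb1⟩, ha1', hb1'⟩, ⟨ha2, hb2⟩, ha2', hb2'⟩ := hp
  have hsc : ∀ t ∈ Icc (0 : ℝ) 1, ∀ x : ℝ, |t * x| ≤ |x| := fun t ht x => by
    rw [abs_mul, abs_of_nonneg ht.1]
    exact mul_le_of_le_one_left (abs_nonneg x) ht.2
  have hcont : ∀ x y : ℝ, |x - u| < ε₂ → |y| < ε₂ →
      IntervalIntegrable (fun t : ℝ => h (x, t * y)) volume 0 1 := by
    intro x y hx hy
    apply ContinuousOn.intervalIntegrable
    intro t ht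
    rw [uIcc_of_le zero_le_one] at ht
    have h2 : ContinuousAt h (x, t * y) := H2 _ (by
      simp only [mem_ball, Prod.dist_eq, Real.dist_eq, sub_zero, max_lt_iff]
      exact ⟨hx, (hsc t ht y).trans_lt hy⟩)
    have h3 : ContinuousAt (fun t : ℝ => (x, t * y)) t := by fun_prop
    exact (ContinuousAt.comp (f := fun t : ℝ => (x, t * y)) h2 h3).continuousWithinAt
  have hi := hcont a b ha2 hb2
  have hi' := hcont a' b' ha2' hb2'
  have hlin := ContinuousLinearMap.apply_prod_eq h'
  have key : _root_.vertAvg h (a, b) - _root_.vertAvg h (a', b') - (h'.comp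
      ((ContinuousLinearMap.fst ℝ ℝ ℝ).prod ((1 / 2 : ℝ) • ContinuousLinearMap.snd ℝ ℝ ℝ)))
        ((a, b) - (a', b'))
      = ∫ t in (0 : ℝ)..1, (h (a, t * b) - h (a', t * b')
          - h' ((a, t * b) - (a', t * b'))) := by
    have e : ∀ t : ℝ, h' ((a, t * b) - (a', t * b'))
        = h' (1, 0) * (a - a') + t * (h' (0, 1) * (b - b')) := by
      intro t
      rw [Prod.mk_sub_mk, hlin]
      ring
    simp only [e]
    rw [intervalIntegral.integral_sub (hi.sub hi')
      (Continuous.intervalIntegrable (by fun_prop) _ _), intervalIntegral.integral_sub hi hi',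
      intervalIntegral.integral_add (Continuous.intervalIntegrable (by fun_prop) _ _)
      (Continuous.intervalIntegrable (by fun_prop) _ _), intervalIntegral.integral_const,
      intervalIntegral.integral_mul_const, integral_id]
    have e' : (h'.comp ((ContinuousLinearMap.fst ℝ ℝ ℝ).prod
        ((1 / 2 : ℝ) • ContinuousLinearMap.snd ℝ ℝ ℝ))) ((a, b) - (a', b'))
        = h' (1, 0) * (a - a') + h' (0, 1) * (1 / 2 * (b - b')) := hlin _ _
    rw [e']
    simp only [_root_.vertAvg, smul_eq_mul]
    ring
  rw [key]
  have hb : ∀ t ∈ uIoc (0 : ℝ) 1, ‖h (a, t * b) - h (a', t * b') - h' ((a, t * b) - (a', t * b'))‖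
      ≤ c * ‖((a, b) - (a', b') : ℝ × ℝ)‖ := by
    intro t ht
    rw [uIoc_of_le zero_le_one] at ht
    have ht' : t ∈ Icc (0 : ℝ) 1 := ⟨ht.1.le, ht.2⟩
    refine (H1 ((a, t * b), (a', t * b')) ?_).trans ?_
    · simp only [mem_ball, Prod.dist_eq, Real.dist_eq, sub_zero, max_lt_iff]
      exact ⟨⟨ha1, (hsc t ht' b).trans_lt hb1⟩, ha1', (hsc t ht' b').trans_lt hb1'⟩
    · gcongr
      simp only [Prod.mk_sub_mk, Prod.norm_def, Real.norm_eq_abs, ← mul_sub]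
      exact max_le_max le_rfl (hsc t ht' _)
  simpa using intervalIntegral.norm_integral_le_of_norm_le_const hb

theorem exists_continuousLinearEquiv_of_jacobian_ne_zero {L₁ L₂ : ℝ × ℝ →L[ℝ] ℝ}
    (hL : L₁ (1, 0) * L₂ (0, 1) - L₁ (0, 1) * L₂ (1, 0) ≠ 0) :
    ∃ e : (ℝ × ℝ) ≃L[ℝ] (ℝ × ℝ), (e : (ℝ × ℝ) →L[ℝ] (ℝ × ℝ)) = L₁.prod L₂ := by
  have hinj : Function.Injective (L₁.prod L₂ : ℝ × ℝ →ₗ[ℝ] ℝ × ℝ) := by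
    rw [injective_iff_map_eq_zero]
    rintro ⟨x, y⟩ h
    simp only [ContinuousLinearMap.coe_coe, ContinuousLinearMap.prod_apply, Prod.mk_eq_zero] at h
    rw [L₁.apply_prod_eq x y, L₂.apply_prod_eq x y] at h
    obtain ⟨h1, h2⟩ := h
    have hx : x = 0 := by
      apply (mul_eq_zero.1 (_ : (L₁ (1, 0) * L₂ (0, 1) - L₁ (0, 1) * L₂ (1, 0)) * x = 0)).resolve_left
        hL
      linear_combination L₂ (0, 1) * h1 - L₁ (0, 1) * h2
    have hy : y = 0 := by
      apply (mul_eq_zero.1 (_ : (L₁ (1, 0) * L₂ (0, 1) - L₁ (0, 1) * L₂ (1, 0)) * y = 0)).resolve_left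
        hL
      linear_combination L₁ (1, 0) * h2 - L₂ (1, 0) * h1
    simp [hx, hy]
  exact ⟨(LinearEquiv.ofInjectiveEndo _ hinj).toContinuousLinearEquiv, by ext <;> rfl⟩

theorem isConnected_ball_diff_zero {δ : ℝ} (hδ : 0 < δ) :
    IsConnected (ball (0 : ℝ × ℝ) δ \ {0}) := by
  have hrank : 1 < Module.rank ℝ (ℝ × ℝ) := by
    simp only [rank_prod', Module.rank_self]
    norm_num
  have himg : ball (0 : ℝ × ℝ) δ \ {0}
      = (fun x : ℝ × ℝ => (δ / (1 + ‖x‖)) • x) '' {0}ᶜ := by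
    ext y
    simp only [Set.mem_sdiff, mem_ball_zero_iff, mem_singleton_iff, mem_image, mem_compl_iff]
    constructor
    · rintro ⟨hy, hy0⟩
      have hpos : 0 < δ - ‖y‖ := sub_pos.2 hy
      refine ⟨(δ - ‖y‖)⁻¹ • y, by simp [hpos.ne', hy0], ?_⟩
      rw [norm_smul, norm_inv, Real.norm_of_nonneg hpos.le, smul_smul]
      have : δ / (1 + (δ - ‖y‖)⁻¹ * ‖y‖) * (δ - ‖y‖)⁻¹ = 1 := by
        have : 1 + (δ - ‖y‖)⁻¹ * ‖y‖ = δ * (δ - ‖y‖)⁻¹ := by field_simp; ring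
        rw [this]
        field_simp
      rw [this, one_smul]
    · rintro ⟨x, hx, rfl⟩
      have hpos : 0 < 1 + ‖x‖ := by positivity
      refine ⟨?_, by simp [hx, hδ.ne', hpos.ne']⟩
      rw [norm_smul, Real.norm_of_nonneg (by positivity), div_mul_eq_mul_div, div_lt_iff₀ hpos]
      nlinarith
  rw [himg]
  refine (isConnected_compl_singleton_of_one_lt_rank hrank 0).image _ ?_
  refine Continuous.continuousOn ?_
  have : Continuous fun x : ℝ × ℝ => δ / (1 + ‖x‖) :=
    continuous_const.div (by fun_prop) fun x => by positivity
  exact this.smul continuous_id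

theorem vertAvg_zero (h : ℝ × ℝ → ℝ) (u : ℝ) : vertAvg h (u, 0) = h (u, 0) := by
  simp [vertAvg]

theorem mem_strip2_zero {R : ℝ} (hR : 0 < R) (u : ℝ) : ((u, 0) : ℝ × ℝ) ∈ Strip2 R :=
  ⟨neg_lt_zero.2 hR, hR⟩

theorem isOpen_strip2 (R : ℝ) : IsOpen (Strip2 R) :=
  (isOpen_lt continuous_const continuous_snd).inter (isOpen_lt continuous_snd continuous_const)

theorem isOpen_strip (R : ℝ) : IsOpen (Strip R) :=
  (isOpen_lt continuous_const continuous_snd).inter (isOpen_lt continuous_snd continuous_const)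

theorem strip_subset_strip2 {r R : ℝ} (hr : r ≤ R) : Strip r ⊆ Strip2 R := fun _ hp =>
  ⟨by linarith [hp.1, hp.2], hp.2.trans_le hr⟩

theorem exists_hasStrictFDerivAt_vertAvg_pd2 {f : ℝ × ℝ → ℝ} {R : ℝ} (hR : 0 < R)
    (hf : AnalyticOnNhd ℝ f (Strip2 R)) {k : ℝ → ℝ} (hk : ∀ u, pd2 f (u, 0) = k u)
    {k' u : ℝ} (hk' : HasDerivAt k k' u) :
    ∃ D : ℝ × ℝ →L[ℝ] ℝ, HasStrictFDerivAt (vertAvg (pd2 f)) D (u, 0) ∧ D (1, 0) = k' := by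
  have ha : ∀ p ∈ Strip2 R, AnalyticAt ℝ (pd2 f) p := fun p hp =>
    ((ContinuousLinearMap.apply ℝ ℝ ((0, 1) : ℝ × ℝ)).analyticAt _).comp (hf p hp).fderiv
  have hu := mem_strip2_zero hR u
  have hs := (ha _ hu).hasStrictFDerivAt
  refine ⟨_, hs.vertAvg ?_, ?_⟩
  · filter_upwards [(isOpen_strip2 R).mem_nhds hu] with p hp using (ha p hp).continuousAt
  · have h1 : HasDerivAt (fun x : ℝ => ((x, 0) : ℝ × ℝ)) (1, 0) u :=
      (hasDerivAt_id u).prodMk (hasDerivAt_const u 0)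
    have h2 : HasDerivAt (fun x : ℝ => pd2 f (x, 0)) (fderiv ℝ (pd2 f) (u, 0) (1, 0)) u :=
      HasFDerivAt.comp_hasDerivAt (l := pd2 f) u hs.hasFDerivAt h1
    simp only [hk] at h2
    simpa using h2.unique hk'

/-- `(f₁, f₂)` vanishes on `v = 0`, with conormal derivative `A(u)(cos u, -sin u)`. -/
structure IsBlowup (f₁ f₂ : ℝ × ℝ → ℝ) (A : ℝ → ℝ) (R : ℝ) : Prop where
  pos : 0 < R
  analytic₁ : AnalyticOnNhd ℝ f₁ (Strip2 R)
  analytic₂ : AnalyticOnNhd ℝ f₂ (Strip2 R)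
  zero₁ : ∀ u, f₁ (u, 0) = 0
  zero₂ : ∀ u, f₂ (u, 0) = 0
  deriv₁ : ∀ u, pd2 f₁ (u, 0) = A u * Real.cos u
  deriv₂ : ∀ u, pd2 f₂ (u, 0) = -(A u * Real.sin u)
  differentiable : Differentiable ℝ A
  ne_zero : ∀ u, A u ≠ 0
  periodic₁ : ∀ u v, f₁ (u + 2 * π, v) = f₁ (u, v)
  periodic₂ : ∀ u v, f₂ (u + 2 * π, v) = f₂ (u, v)

namespace IsBlowup

variable {f₁ f₂ : ℝ × ℝ → ℝ} {A : ℝ → ℝ} {R : ℝ}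

theorem exists_hasStrictFDerivAt (h : IsBlowup f₁ f₂ A R) (u : ℝ) :
    ∃ D₁ D₂ : ℝ × ℝ →L[ℝ] ℝ, HasStrictFDerivAt (vertAvg (pd2 f₁)) D₁ (u, 0) ∧
      HasStrictFDerivAt (vertAvg (pd2 f₂)) D₂ (u, 0) ∧
      D₁ (1, 0) = deriv A u * Real.cos u + A u * -Real.sin u ∧
      D₂ (1, 0) = -(deriv A u * Real.sin u + A u * Real.cos u) := by
  have hA := (h.differentiable u).hasDerivAt
  obtain ⟨D₁, h1, h1'⟩ := exists_hasStrictFDerivAt_vertAvg_pd2 h.pos h.analytic₁ h.deriv₁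
    (hA.mul (Real.hasDerivAt_cos u))
  obtain ⟨D₂, h2, h2'⟩ := exists_hasStrictFDerivAt_vertAvg_pd2 h.pos h.analytic₂ h.deriv₂
    (hA.mul (Real.hasDerivAt_sin u)).neg
  exact ⟨D₁, D₂, h1, h2, h1', h2'⟩

theorem exists_nhds_injOn (h : IsBlowup f₁ f₂ A R) (u : ℝ) :
    ∃ N ∈ 𝓝 ((u, 0) : ℝ × ℝ), ∀ p ∈ N, ∀ q ∈ N, p.2 ≠ 0 → q.2 ≠ 0 →
      f₁ p = f₁ q → f₂ p = f₂ q → p = q := by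
  obtain ⟨D₁, D₂, h1, h2, h1', h2'⟩ := h.exists_hasStrictFDerivAt u
  set g₁ := vertAvg (pd2 f₁)
  set g₂ := vertAvg (pd2 f₂)
  set c := Real.cos u
  set s := Real.sin u
  have hcs : s ^ 2 + c ^ 2 = 1 := Real.sin_sq_add_cos_sq u
  have e1 : g₁ (u, 0) = A u * c := (vertAvg_zero _ u).trans (h.deriv₁ u)
  have e2 : g₂ (u, 0) = -(A u * s) := (vertAvg_zero _ u).trans (h.deriv₂ u)
  have hX : HasStrictFDerivAt (fun p => c * g₁ p - s * g₂ p) (c • D₁ - s • D₂) (u, 0) :=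
    (h1.const_mul c).sub (h2.const_mul s)
  have hY : HasStrictFDerivAt (fun p => s * g₁ p + c * g₂ p) (s • D₁ + c • D₂) (u, 0) :=
    (h1.const_mul s).add (h2.const_mul c)
  have eX : c * g₁ (u, 0) - s * g₂ (u, 0) = A u := by
    rw [e1, e2]; linear_combination A u * hcs
  have eY : s * g₁ (u, 0) + c * g₂ (u, 0) = 0 := by
    rw [e1, e2]; ring
  have hX0 : c * g₁ (u, 0) - s * g₂ (u, 0) ≠ 0 := eX ▸ h.ne_zero u
  have hinv := (hasStrictDerivAt_inv hX0).comp_hasStrictFDerivAt ((u, 0) : ℝ × ℝ) hX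
  have hF₁ : HasStrictFDerivAt
      (fun p => (s * g₁ p + c * g₂ p) * (c * g₁ p - s * g₂ p)⁻¹)
      ((A u)⁻¹ • (s • D₁ + c • D₂)) (u, 0) :=
    (hY.mul hinv).congr_fderiv (by simp [eX, eY])
  have hsnd : HasStrictFDerivAt (fun p : ℝ × ℝ => p.2) (ContinuousLinearMap.snd ℝ ℝ ℝ) (u, 0) :=
    hasStrictFDerivAt_snd
  have hF₂ : HasStrictFDerivAt (fun p => p.2 * (c * g₁ p - s * g₂ p))
      (A u • ContinuousLinearMap.snd ℝ ℝ ℝ) (u, 0) :=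
    (hsnd.mul hX).congr_fderiv (by simp [eX])
  obtain ⟨e, he⟩ := exists_continuousLinearEquiv_of_jacobian_ne_zero
      (L₁ := (A u)⁻¹ • (s • D₁ + c • D₂)) (L₂ := A u • ContinuousLinearMap.snd ℝ ℝ ℝ) (by
    have hA := h.ne_zero u
    have hval : (A u)⁻¹ * (s * D₁ (1, 0) + c * D₂ (1, 0)) = -1 := by
      rw [h1', h2', inv_mul_eq_iff_eq_mul₀ hA]
      linear_combination -A u * hcs
    change (A u)⁻¹ * (s * D₁ (1, 0) + c * D₂ (1, 0)) * (A u * 1) - _ * (A u * 0) ≠ 0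
    rw [hval]
    simpa using hA)
  have hF := hF₁.prodMk hF₂
  rw [← he] at hF
  refine ⟨(hF.toOpenPartialHomeomorph _).source ∩ Strip2 R, inter_mem
    ((hF.toOpenPartialHomeomorph _).open_source.mem_nhds hF.mem_toOpenPartialHomeomorph_source)
    ((isOpen_strip2 R).mem_nhds (mem_strip2_zero h.pos u)), ?_⟩
  rintro p ⟨hp, hpR⟩ q ⟨hq, hqR⟩ hp0 hq0 h12 h22
  refine (hF.toOpenPartialHomeomorph _).injOn hp hq ?_
  rw [mul_vertAvg_pd2 h.analytic₁ h.zero₁ hpR, mul_vertAvg_pd2 h.analytic₁ h.zero₁ hqR] at h12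
  rw [mul_vertAvg_pd2 h.analytic₂ h.zero₂ hpR, mul_vertAvg_pd2 h.analytic₂ h.zero₂ hqR] at h22
  change p.2 * g₁ p = q.2 * g₁ q at h12
  change p.2 * g₂ p = q.2 * g₂ q at h22
  have hXpq : p.2 * (c * g₁ p - s * g₂ p) = q.2 * (c * g₁ q - s * g₂ q) := by
    linear_combination c * h12 - s * h22
  have hYpq : p.2 * (s * g₁ p + c * g₂ p) = q.2 * (s * g₁ q + c * g₂ q) := by
    linear_combination s * h12 + c * h22
  simp only [HasStrictFDerivAt.toOpenPartialHomeomorph_coe, Prod.mk.injEq]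
  refine ⟨?_, hXpq⟩
  rw [← div_eq_mul_inv, ← div_eq_mul_inv, ← mul_div_mul_left _ _ hp0, hXpq, hYpq,
    mul_div_mul_left _ _ hq0]

theorem mul_pos_of_ne_zero (h : IsBlowup f₁ f₂ A R) (u u' : ℝ) : 0 < A u * A u' := by
  by_contra! hneg
  have : (0 : ℝ) ∈ range A := by
    rcases mul_nonpos_iff.1 hneg with ⟨h1, h2⟩ | ⟨h1, h2⟩
    · exact mem_range_of_exists_le_of_exists_ge h.differentiable.continuous ⟨u', h2⟩ ⟨u, h1⟩
    · exact mem_range_of_exists_le_of_exists_ge h.differentiable.continuous ⟨u, h1⟩ ⟨u', h2⟩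
  obtain ⟨x, hx⟩ := this
  exact h.ne_zero x hx

theorem periodic_int₁ (h : IsBlowup f₁ f₂ A R) (n : ℤ) (u v : ℝ) :
    f₁ (u + 2 * π * n, v) = f₁ (u, v) := by
  have : Function.Periodic (fun x => f₁ (x, v)) (2 * π) := fun x => h.periodic₁ x v
  simpa [mul_comm] using this.int_mul n u

theorem periodic_int₂ (h : IsBlowup f₁ f₂ A R) (n : ℤ) (u v : ℝ) :
    f₂ (u + 2 * π * n, v) = f₂ (u, v) := by
  have : Function.Periodic (fun x => f₂ (x, v)) (2 * π) := fun x => h.periodic₂ x v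
  simpa [mul_comm] using this.int_mul n u

theorem eventually_injective (h : IsBlowup f₁ f₂ A R) (u u' : ℝ) :
    ∀ᶠ x in 𝓝 (((0, 0), (u, u')) : (ℝ × ℝ) × ℝ × ℝ), 0 < x.1.1 → 0 < x.1.2 →
      f₁ (x.2.1, x.1.1) = f₁ (x.2.2, x.1.2) → f₂ (x.2.1, x.1.1) = f₂ (x.2.2, x.1.2) →
      x.1.1 = x.1.2 ∧ ∃ n : ℤ, x.2.1 - x.2.2 = 2 * π * n := by
  by_cases hn : ∃ n : ℤ, u - u' = 2 * π * n
  · obtain ⟨n, hn⟩ := hn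
    obtain ⟨N, hN, hinj⟩ := h.exists_nhds_injOn u
    have c1 : Tendsto (fun x : (ℝ × ℝ) × ℝ × ℝ => (x.2.1, x.1.1)) (𝓝 ((0, 0), (u, u')))
        (𝓝 (u, 0)) := Continuous.tendsto' (by fun_prop) _ _ rfl
    have c2 : Tendsto (fun x : (ℝ × ℝ) × ℝ × ℝ => (x.2.2 + 2 * π * n, x.1.2))
        (𝓝 ((0, 0), (u, u'))) (𝓝 (u, 0)) :=
      Continuous.tendsto' (by fun_prop) _ _ (by simp [← hn])
    filter_upwards [c1 hN, c2 hN] with x hx1 hx2 hv hw h12 h22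
    have := hinj _ hx1 _ hx2 hv.ne' hw.ne' (by rw [h.periodic_int₁, h12])
      (by rw [h.periodic_int₂, h22])
    rw [Prod.mk.injEq] at this
    exact ⟨this.2, n, by linarith [this.1]⟩
  · have hg : ∀ t : ℝ, ContinuousAt (vertAvg (pd2 f₁)) (t, 0) ∧
        ContinuousAt (vertAvg (pd2 f₂)) (t, 0) := fun t => by
      obtain ⟨D₁, D₂, h1, h2, -, -⟩ := h.exists_hasStrictFDerivAt t
      exact ⟨h1.continuousAt, h2.continuousAt⟩
    have c1 : Tendsto (fun x : (ℝ × ℝ) × ℝ × ℝ => (x.2.1, x.1.1)) (𝓝 ((0, 0), (u, u')))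
        (𝓝 (u, 0)) := Continuous.tendsto' (by fun_prop) _ _ rfl
    have c2 : Tendsto (fun x : (ℝ × ℝ) × ℝ × ℝ => (x.2.2, x.1.2)) (𝓝 ((0, 0), (u, u')))
        (𝓝 (u', 0)) := Continuous.tendsto' (by fun_prop) _ _ rfl
    have t1 := (hg u).1.tendsto.comp c1
    have t2 := (hg u).2.tendsto.comp c1
    have t1' := (hg u').1.tendsto.comp c2
    have t2' := (hg u').2.tendsto.comp c2
    have hcross := (t1.mul t2').sub (t2.mul t1')
    have hdot := (t1.mul t1').add (t2.mul t2')
    simp only [vertAvg_zero, h.deriv₁, h.deriv₂] at hcross hdot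
    have eA := h.mul_pos_of_ne_zero u u'
    have hoc : A u * Real.cos u * -(A u' * Real.sin u') - -(A u * Real.sin u) *
        (A u' * Real.cos u') ≠ 0 ∨ A u * Real.cos u * (A u' * Real.cos u') +
        -(A u * Real.sin u) * -(A u' * Real.sin u') < 0 := by
      have i1 : A u * Real.cos u * -(A u' * Real.sin u') - -(A u * Real.sin u) *
        (A u' * Real.cos u') = A u * A u' * Real.sin (u - u') := by rw [Real.sin_sub]; ring
      have i2 : A u * Real.cos u * (A u' * Real.cos u') +
        -(A u * Real.sin u) * -(A u' * Real.sin u') = A u * A u' * Real.cos (u - u') := by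
        rw [Real.cos_sub]; ring
      rw [i1, i2]
      by_contra! hcon
      have hs : Real.sin (u - u') = 0 := (mul_eq_zero.1 hcon.1).resolve_left eA.ne'
      have hc : 0 ≤ Real.cos (u - u') := nonneg_of_mul_nonneg_right hcon.2 eA
      have hc1 : Real.cos (u - u') = 1 := by
        have := Real.sin_sq_add_cos_sq (u - u')
        rw [hs] at this
        nlinarith
      obtain ⟨n, hn'⟩ := (Real.cos_eq_one_iff _).1 hc1
      exact hn ⟨n, by rw [← hn']; ring⟩
    have hmem : ∀ᶠ x in 𝓝 (((0, 0), (u, u')) : (ℝ × ℝ) × ℝ × ℝ),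
        (x.2.1, x.1.1) ∈ Strip2 R ∧ (x.2.2, x.1.2) ∈ Strip2 R :=
      (c1.eventually ((isOpen_strip2 R).mem_nhds (mem_strip2_zero h.pos u))).and
        (c2.eventually ((isOpen_strip2 R).mem_nhds (mem_strip2_zero h.pos u')))
    have hfin : ∀ᶠ x in 𝓝 (((0, 0), (u, u')) : (ℝ × ℝ) × ℝ × ℝ), 0 < x.1.1 → 0 < x.1.2 →
        ¬(f₁ (x.2.1, x.1.1) = f₁ (x.2.2, x.1.2) ∧ f₂ (x.2.1, x.1.1) = f₂ (x.2.2, x.1.2)) := by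
      rcases hoc with hoc | hoc
      · filter_upwards [hcross.eventually_ne hoc, hmem] with x hx ⟨m1, m2⟩ hv hw ⟨h12, h22⟩
        simp only [Function.comp_apply] at hx
        rw [mul_vertAvg_pd2 h.analytic₁ h.zero₁ m1, mul_vertAvg_pd2 h.analytic₁ h.zero₁ m2] at h12
        rw [mul_vertAvg_pd2 h.analytic₂ h.zero₂ m1, mul_vertAvg_pd2 h.analytic₂ h.zero₂ m2] at h22
        simp only at h12 h22
        refine hx ((mul_eq_zero.1 ?_).resolve_left (mul_pos hv hw).ne')
        linear_combination x.1.2 * vertAvg (pd2 f₂) (x.2.2, x.1.2) * h12 -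
          x.1.2 * vertAvg (pd2 f₁) (x.2.2, x.1.2) * h22
      · filter_upwards [hdot.eventually_lt_const hoc, hmem] with x hx ⟨m1, m2⟩ hv hw ⟨h12, h22⟩
        simp only [Function.comp_apply] at hx
        rw [mul_vertAvg_pd2 h.analytic₁ h.zero₁ m1, mul_vertAvg_pd2 h.analytic₁ h.zero₁ m2] at h12
        rw [mul_vertAvg_pd2 h.analytic₂ h.zero₂ m1, mul_vertAvg_pd2 h.analytic₂ h.zero₂ m2] at h22
        simp only at h12 h22
        have := mul_neg_of_pos_of_neg (mul_pos hv hw) hx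
        have e : x.1.1 * x.1.2 * (vertAvg (pd2 f₁) (x.2.1, x.1.1) *
            vertAvg (pd2 f₁) (x.2.2, x.1.2) + vertAvg (pd2 f₂) (x.2.1, x.1.1) *
            vertAvg (pd2 f₂) (x.2.2, x.1.2)) =
            (x.1.2 * vertAvg (pd2 f₁) (x.2.2, x.1.2)) ^ 2 +
            (x.1.2 * vertAvg (pd2 f₂) (x.2.2, x.1.2)) ^ 2 := by
          linear_combination x.1.2 * vertAvg (pd2 f₁) (x.2.2, x.1.2) * h12 +
            x.1.2 * vertAvg (pd2 f₂) (x.2.2, x.1.2) * h22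
        rw [e] at this
        linarith [sq_nonneg (x.1.2 * vertAvg (pd2 f₁) (x.2.2, x.1.2)),
          sq_nonneg (x.1.2 * vertAvg (pd2 f₂) (x.2.2, x.1.2))]
    filter_upwards [hfin] with x hx hv hw h12 h22 using absurd ⟨h12, h22⟩ (hx hv hw)

theorem eventually_ne_zero (h : IsBlowup f₁ f₂ A R) (u : ℝ) :
    ∀ᶠ x in 𝓝 ((0, u) : ℝ × ℝ), 0 < x.1 → (f₁ (x.2, x.1), f₂ (x.2, x.1)) ≠ 0 := by
  obtain ⟨D₁, D₂, h1, h2, -, -⟩ := h.exists_hasStrictFDerivAt u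
  have c1 : Tendsto (fun x : ℝ × ℝ => (x.2, x.1)) (𝓝 (0, u)) (𝓝 (u, 0)) :=
    Continuous.tendsto' (by fun_prop) _ _ rfl
  have hsq := ((h1.continuousAt.tendsto.comp c1).pow 2).add
    ((h2.continuousAt.tendsto.comp c1).pow 2)
  simp only [vertAvg_zero, h.deriv₁, h.deriv₂] at hsq
  have hne : (A u * Real.cos u) ^ 2 + (-(A u * Real.sin u)) ^ 2 ≠ 0 := by
    have : (A u * Real.cos u) ^ 2 + (-(A u * Real.sin u)) ^ 2 = A u ^ 2 := by
      linear_combination A u ^ 2 * Real.sin_sq_add_cos_sq u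
    rw [this]
    exact pow_ne_zero 2 (h.ne_zero u)
  filter_upwards [hsq.eventually_ne hne,
    c1.eventually ((isOpen_strip2 R).mem_nhds (mem_strip2_zero h.pos u))] with x hx hm hv h0
  rw [Prod.mk_eq_zero, mul_vertAvg_pd2 h.analytic₁ h.zero₁ hm,
    mul_vertAvg_pd2 h.analytic₂ h.zero₂ hm] at h0
  apply hx
  simp only [Function.comp_apply, (mul_eq_zero.1 h0.1).resolve_left hv.ne',
    (mul_eq_zero.1 h0.2).resolve_left hv.ne']
  norm_num

/-- On a thin strip, `(f₁, f₂)` omits the origin and is injective modulo the period. -/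
theorem exists_strip (h : IsBlowup f₁ f₂ A R) :
    ∃ r, 0 < r ∧ r ≤ R ∧ (∀ p ∈ Strip r, (f₁ p, f₂ p) ≠ 0) ∧
      ∀ p ∈ Strip r, ∀ q ∈ Strip r, f₁ p = f₁ q → f₂ p = f₂ q →
        p.2 = q.2 ∧ ∃ n : ℤ, p.1 - q.1 = 2 * π * n := by
  have hK : IsCompact (Icc (0 : ℝ) (2 * π)) := isCompact_Icc
  have e1 := (hK.prod hK).eventually_forall_of_forall_eventually
    (x₀ := ((0, 0) : ℝ × ℝ)) (P := fun v y => 0 < v.1 → 0 < v.2 →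
      f₁ (y.1, v.1) = f₁ (y.2, v.2) → f₂ (y.1, v.1) = f₂ (y.2, v.2) →
      v.1 = v.2 ∧ ∃ n : ℤ, y.1 - y.2 = 2 * π * n) fun y _ => h.eventually_injective y.1 y.2
  have e2 := hK.eventually_forall_of_forall_eventually
    (x₀ := (0 : ℝ)) (P := fun v u => 0 < v → (f₁ (u, v), f₂ (u, v)) ≠ 0)
    fun y _ => h.eventually_ne_zero y
  obtain ⟨ε₁, hε₁, H1⟩ := Metric.eventually_nhds_iff_ball.1 e1
  obtain ⟨ε₂, hε₂, H2⟩ := Metric.eventually_nhds_iff_ball.1 e2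
  have hred : ∀ u : ℝ, ∃ n : ℤ, u + 2 * π * n ∈ Icc (0 : ℝ) (2 * π) := fun u => by
    have := Ico_subset_Icc_self (sub_toIcoDiv_zsmul_mem_Ico Real.two_pi_pos 0 u)
    refine ⟨-toIcoDiv Real.two_pi_pos 0 u, ?_⟩
    rw [zero_add, zsmul_eq_mul] at this
    convert this using 1
    push_cast
    ring
  refine ⟨min R (min ε₁ ε₂), lt_min h.pos (lt_min hε₁ hε₂), min_le_left _ _, ?_, ?_⟩
  · rintro ⟨u, v⟩ ⟨hv, hvr⟩
    simp only [lt_min_iff] at hv hvr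
    obtain ⟨n, hn⟩ := hred u
    have := H2 v (by simpa [abs_of_pos hv] using hvr.2.2) _ hn hv
    rwa [h.periodic_int₁, h.periodic_int₂] at this
  · rintro ⟨u, v⟩ ⟨hv, hvr⟩ ⟨u', v'⟩ ⟨hv', hvr'⟩ h12 h22
    simp only [lt_min_iff] at hv hvr hv' hvr'
    obtain ⟨n, hn⟩ := hred u
    obtain ⟨n', hn'⟩ := hred u'
    obtain ⟨i1, m, i2⟩ := H1 (v, v')
      (by
        simp only [mem_ball, Prod.dist_eq, Real.dist_eq, sub_zero, max_lt_iff, abs_of_pos hv,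
          abs_of_pos hv']
        exact ⟨hvr.2.1, hvr'.2.1⟩)
      (_, _) ⟨hn, hn'⟩ hv hv' (by simpa only [h.periodic_int₁] using h12)
      (by simpa only [h.periodic_int₂] using h22)
    refine ⟨i1, m - n + n', ?_⟩
    push_cast
    simp only at i2 ⊢
    linarith

theorem map_nhds_eq (h : IsBlowup f₁ f₂ A R) {p : ℝ × ℝ} (hp : p ∈ Strip R)
    (hjac : 0 < pd1 f₁ p * pd2 f₂ p - pd2 f₁ p * pd1 f₂ p) :
    map (fun q => (f₁ q, f₂ q)) (𝓝 p) = 𝓝 (f₁ p, f₂ p) := by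
  have hp2 := strip_subset_strip2 le_rfl hp
  obtain ⟨e, he⟩ := exists_continuousLinearEquiv_of_jacobian_ne_zero hjac.ne'
  have := (h.analytic₁ p hp2).hasStrictFDerivAt.prodMk (h.analytic₂ p hp2).hasStrictFDerivAt
  rw [← he] at this
  exact this.map_nhds_eq_of_equiv

theorem insert_image_strip_mem_nhds (h : IsBlowup f₁ f₂ A R)
    (hjac : ∀ p ∈ Strip R, 0 < pd1 f₁ p * pd2 f₂ p - pd2 f₁ p * pd1 f₂ p) {r : ℝ} (hr : 0 < r)
    (hrR : r ≤ R) (hne : ∀ p ∈ Strip r, (f₁ p, f₂ p) ≠ 0) :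
    insert 0 ((fun p => (f₁ p, f₂ p)) '' Strip r) ∈ 𝓝 (0 : ℝ × ℝ) := by
  set F : ℝ × ℝ → ℝ × ℝ := fun p => (f₁ p, f₂ p) with hFdef
  have hcont : ContinuousOn F (Strip2 R) :=
    h.analytic₁.continuousOn.prodMk h.analytic₂.continuousOn
  obtain ⟨ρ, hρ, hρr⟩ := exists_between hr
  have hredp : ∀ u v : ℝ, ∃ u' ∈ Icc (0 : ℝ) (2 * π), F (u', v) = F (u, v) := fun u v => by
    have := Ico_subset_Icc_self (sub_toIcoDiv_zsmul_mem_Ico Real.two_pi_pos 0 u)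
    rw [zero_add, zsmul_eq_mul] at this
    refine ⟨_, this, ?_⟩
    have e : u - toIcoDiv Real.two_pi_pos 0 u * (2 * π)
        = u + 2 * π * ((-toIcoDiv Real.two_pi_pos 0 u : ℤ) : ℝ) := by push_cast; ring
    simp only [hFdef, e, h.periodic_int₁, h.periodic_int₂]
  have hsub : ∀ s : Set ℝ, s ⊆ Icc 0 ρ → Icc (0 : ℝ) (2 * π) ×ˢ s ⊆ Strip2 R := fun s hs p hp =>
    ⟨by linarith [(hs hp.2).1, h.pos], by linarith [(hs hp.2).2]⟩
  have hcomp : ∀ s : Set ℝ, s ⊆ Icc 0 ρ → IsCompact s →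
      IsClosed (F '' (Icc (0 : ℝ) (2 * π) ×ˢ s)) := fun s hs hsc =>
    ((isCompact_Icc.prod hsc).image_of_continuousOn (hcont.mono (hsub s hs))).isClosed
  have hcl₁ := hcomp {ρ} (by simpa using hρ.le) isCompact_singleton
  have hcl := hcomp (Icc 0 ρ) Subset.rfl isCompact_Icc
  have h0 : (0 : ℝ × ℝ) ∉ F '' (Icc (0 : ℝ) (2 * π) ×ˢ {ρ}) := by
    rintro ⟨⟨u, v⟩, ⟨-, hv⟩, hF⟩
    obtain rfl : v = ρ := hv
    exact hne (u, v) ⟨hρ, hρr⟩ hF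
  obtain ⟨δ, hδ, hball⟩ := Metric.isOpen_iff.1 hcl₁.isOpen_compl 0 h0
  have hopen : IsOpen (F '' Strip ρ) := by
    rw [isOpen_iff_mem_nhds]
    rintro _ ⟨p, hp, rfl⟩
    have hpR : p ∈ Strip R := ⟨hp.1, hp.2.trans (hρr.trans_le hrR)⟩
    rw [← h.map_nhds_eq hpR (hjac p hpR)]
    exact image_mem_map ((isOpen_strip ρ).mem_nhds hp)
  have hdisj : Disjoint (F '' Strip ρ) (F '' (Icc (0 : ℝ) (2 * π) ×ˢ Icc 0 ρ))ᶜ := by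
    rw [disjoint_compl_right_iff_subset]
    rintro _ ⟨⟨u, v⟩, hp, rfl⟩
    obtain ⟨u', hu', hF⟩ := hredp u v
    exact ⟨(u', v), ⟨hu', hp.1.le, hp.2.le⟩, hF⟩
  have hunion : ball (0 : ℝ × ℝ) δ \ {0} ⊆
      F '' Strip ρ ∪ (F '' (Icc (0 : ℝ) (2 * π) ×ˢ Icc 0 ρ))ᶜ := by
    rintro w ⟨hw, hw0⟩
    by_cases hwm : w ∈ F '' (Icc (0 : ℝ) (2 * π) ×ˢ Icc 0 ρ)
    · left
      obtain ⟨⟨u, v⟩, ⟨hu, hv0, hv1⟩, rfl⟩ := hwm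
      refine ⟨(u, v), ⟨lt_of_le_of_ne hv0 ?_, lt_of_le_of_ne hv1 ?_⟩, rfl⟩
      · rintro hv
        simp only at hv
        subst hv
        exact hw0 (Prod.ext (h.zero₁ u) (h.zero₂ u))
      · rintro hv
        exact hball hw ⟨(u, v), ⟨hu, hv⟩, rfl⟩
    · exact Or.inr hwm
  have hnonempty : ((ball (0 : ℝ × ℝ) δ \ {0}) ∩ F '' Strip ρ).Nonempty := by
    have hF0 : F (0, 0) = 0 := Prod.ext (h.zero₁ 0) (h.zero₂ 0)
    have hc : ContinuousAt F (0, 0) :=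
      hcont.continuousAt ((isOpen_strip2 R).mem_nhds (mem_strip2_zero h.pos 0))
    have hc2 : Tendsto (fun v : ℝ => F (0, v)) (𝓝 0) (𝓝 0) := by
      have := hc.tendsto.comp
        (Continuous.tendsto' (f := fun v : ℝ => ((0 : ℝ), v)) (by fun_prop) 0 (0, 0) rfl)
      rwa [hF0] at this
    have hev : ∀ᶠ v in 𝓝[>] (0 : ℝ), F (0, v) ∈ ball (0 : ℝ × ℝ) δ ∧ v ∈ Ioo 0 ρ :=
      ((hc2.eventually (ball_mem_nhds 0 hδ)).filter_mono nhdsWithin_le_nhds).and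
        (Ioo_mem_nhdsGT hρ)
    obtain ⟨v, hv, hv0, hvρ⟩ := hev.exists
    exact ⟨F (0, v), ⟨hv, hne (0, v) ⟨hv0, hvρ.trans hρr⟩⟩, (0, v), ⟨hv0, hvρ⟩, rfl⟩
  have key := (isConnected_ball_diff_zero hδ).isPreconnected.subset_left_of_subset_union hopen
    hcl.isOpen_compl hdisj hunion hnonempty
  filter_upwards [ball_mem_nhds (0 : ℝ × ℝ) hδ] with w hw
  by_cases hw0 : w = 0
  · exact Or.inl hw0
  · obtain ⟨p, hp, rfl⟩ := key ⟨hw, hw0⟩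
    exact Or.inr ⟨p, ⟨hp.1, hp.2.trans hρr⟩, rfl⟩

end IsBlowup

/-- If `z ∘ (f₁, f₂) = f₃` near `p` and `(f₁, f₂)` has invertible derivative at `p`, then the
derivatives satisfy the chain rule (in particular `z` is differentiable at `(f₁ p, f₂ p)`). -/
theorem fderiv_apply_of_comp_eventuallyEq {f₁ f₂ f₃ z : ℝ × ℝ → ℝ} {p : ℝ × ℝ}
    {D₁ D₂ D₃ : ℝ × ℝ →L[ℝ] ℝ} (h₁ : HasStrictFDerivAt f₁ D₁ p)
    (h₂ : HasStrictFDerivAt f₂ D₂ p) (h₃ : HasStrictFDerivAt f₃ D₃ p)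
    (hJ : D₁ (1, 0) * D₂ (0, 1) - D₁ (0, 1) * D₂ (1, 0) ≠ 0)
    (hz : ∀ᶠ q in 𝓝 p, z (f₁ q, f₂ q) = f₃ q) (w : ℝ × ℝ) :
    fderiv ℝ z (f₁ p, f₂ p) (D₁ w, D₂ w) = D₃ w := by
  obtain ⟨e, he⟩ := exists_continuousLinearEquiv_of_jacobian_ne_zero hJ
  have hF := h₁.prodMk h₂
  have hF' := hF
  rw [← he] at hF
  have hinv := hF.to_localInverse
  have hp : hF.localInverse (fun q => (f₁ q, f₂ q)) e p (f₁ p, f₂ p) = p :=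
    hF.localInverse_apply_image
  have h₃' : HasFDerivAt f₃ D₃ (hF.localInverse (fun q => (f₁ q, f₂ q)) e p (f₁ p, f₂ p)) := by
    rw [hp]
    exact h₃.hasFDerivAt
  have hcomp := h₃'.comp (f₁ p, f₂ p) hinv.hasFDerivAt
  have htend : Tendsto (hF.localInverse (fun q => (f₁ q, f₂ q)) e p) (𝓝 (f₁ p, f₂ p)) (𝓝 p) :=
    hF.localInverse_tendsto
  have hzd : DifferentiableAt ℝ z (f₁ p, f₂ p) := by
    refine (hcomp.congr_of_eventuallyEq ?_).differentiableAt
    filter_upwards [htend.eventually hz, hF.eventually_right_inverse] with y hy hy'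
    rw [← hy', Function.comp_apply, hy', ← hy]
    exact congrArg z hy'.symm
  have hchain := HasFDerivAt.comp (g := z) p hzd.hasFDerivAt hF'.hasFDerivAt
  have := hchain.unique (h₃.hasFDerivAt.congr_of_eventuallyEq hz)
  exact congrArg (fun M : ℝ × ℝ →L[ℝ] ℝ => M w) this

theorem gradient_sq_lt_one_of_spacelike {a b : R3} {x y : ℝ}
    (hJ : 0 < a.1 * b.2.1 - b.1 * a.2.1) (hab : lor a a = lor b b) (ha : 0 < lor a a)
    (h0 : lor a b = 0) (ha₃ : x * a.1 + y * a.2.1 = a.2.2) (hb₃ : x * b.1 + y * b.2.1 = b.2.2) :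
    x ^ 2 + y ^ 2 < 1 := by
  by_contra! hm
  set J := a.1 * b.2.1 - b.1 * a.2.1 with hJd
  set S := x * b.2.1 - y * b.1 with hS
  set T := a.1 * y - a.2.1 * x with hT
  have key : J ^ 2 * ((x ^ 2 + y ^ 2) - (x ^ 2 + y ^ 2) ^ 2) = lor a a * (S ^ 2 + T ^ 2) := by
    have : lor a a * (S ^ 2 + T ^ 2) = S ^ 2 * lor a a + 2 * S * T * lor a b + T ^ 2 * lor b b := by
      rw [h0, ← hab]; ring
    rw [this]
    simp only [lor, ← ha₃, ← hb₃, hJd, hS, hT]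
    ring
  have hle : J ^ 2 * ((x ^ 2 + y ^ 2) - (x ^ 2 + y ^ 2) ^ 2) ≤ 0 :=
    mul_nonpos_of_nonneg_of_nonpos (sq_nonneg J) (by nlinarith)
  rw [key] at hle
  have hST : S ^ 2 + T ^ 2 ≤ 0 := nonpos_of_mul_nonpos_right hle ha
  have hS0 : S = 0 := by nlinarith [sq_nonneg S, sq_nonneg T]
  have hT0 : T = 0 := by nlinarith [sq_nonneg S, sq_nonneg T]
  have hx : J * x = 0 := by linear_combination a.1 * hS0 + b.1 * hT0
  have hy : J * y = 0 := by linear_combination a.2.1 * hS0 + b.2.1 * hT0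
  rw [(mul_eq_zero.1 hx).resolve_left hJ.ne', (mul_eq_zero.1 hy).resolve_left hJ.ne'] at hm
  norm_num at hm

end

/-- Claim 3 in Theorem `existence`: the planar projection of the
Cauchy-problem solution induces, on a smaller strip, a diffeomorphism from
`(ℝ/2πℤ) × (0,R')` onto a punctured neighborhood of the origin; consequently
`ψ(ℝ × (0,R'))` is a spacelike graph `z = z(x,y)` over that punctured neighborhood. -/
theorem stmt9 (O : Set R3) (R : ℝ) (H : R3 → ℝ) (A : ℝ → ℝ) (ψ : ℝ × ℝ → R3)
    (hR : 0 < R) (hO : IsOpen O) (h0O : ((0, 0, 0) : R3) ∈ O)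
    (hHa : AnalyticOnNhd ℝ H O) (hHpos : ∀ p ∈ O, 0 < H p)
    (hAa : AnalyticOnNhd ℝ A univ) (hAper : ∀ u : ℝ, A (u + 2 * π) = A u)
    (hA0 : ∀ u : ℝ, A u ≠ 0)
    (hψO : ∀ p ∈ Strip2 R, ψ p ∈ O)
    (hψa : AnalyticOnNhd ℝ ψ (Strip2 R))
    (hper : ∀ u v : ℝ, ψ (u + 2 * π, v) = ψ (u, v))
    (hsys : ∀ p ∈ Strip2 R,
      pd1 (pd1 ψ) p + pd2 (pd2 ψ) p = (2 * H (ψ p)) • lcross (pd1 ψ p) (pd2 ψ p))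
    (h0 : ∀ u : ℝ, ψ (u, 0) = (0 : R3))
    (hbv : ∀ u : ℝ, pd2 ψ (u, 0) = (A u * Real.cos u, -(A u * Real.sin u), A u))
    (hconf : ∀ p ∈ Strip2 R,
      lor (pd1 ψ p) (pd1 ψ p) = lor (pd2 ψ p) (pd2 ψ p) ∧
      lor (pd1 ψ p) (pd2 ψ p) = 0)
    (hjac : ∀ p ∈ Strip R,
      0 < pd1 (comp1 ψ) p * pd2 (comp2 ψ) p - pd2 (comp1 ψ) p * pd1 (comp2 ψ) p)
    (hsp : ∀ p ∈ Strip R, 0 < lor (pd1 ψ p) (pd1 ψ p)) :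
    ∃ R' : ℝ, 0 < R' ∧ R' ≤ R ∧ ∃ W : Set (ℝ × ℝ),
      ((0, 0) : ℝ × ℝ) ∉ W ∧
      insert ((0, 0) : ℝ × ℝ) W ∈ nhds ((0, 0) : ℝ × ℝ) ∧
      Pi2 ψ '' Strip R' = W ∧
      (∀ p ∈ Strip R', ∀ q ∈ Strip R', Pi2 ψ p = Pi2 ψ q →
        p.2 = q.2 ∧ ∃ n : ℤ, p.1 - q.1 = 2 * π * n) ∧
      ∃ z : ℝ × ℝ → ℝ,
        (∀ w ∈ W, (zx z w) ^ 2 + (zy z w) ^ 2 < 1) ∧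
        ∀ p ∈ Strip R', comp3 ψ p = z (Pi2 ψ p) := by
  have han : ∀ L : R3 →L[ℝ] ℝ, AnalyticOnNhd ℝ (fun p => L (ψ p)) (Strip2 R) := fun L p hp =>
    (L.analyticAt _).comp (hψa p hp)
  have hfd : ∀ (L : R3 →L[ℝ] ℝ), ∀ p ∈ Strip2 R, ∀ w,
      fderiv ℝ (fun q => L (ψ q)) p w = L (fderiv ℝ ψ p w) := fun L p hp w => by
    have := (L.hasFDerivAt.comp p (hψa p hp).differentiableAt.hasFDerivAt).fderiv
    exact congrArg (fun M : ℝ × ℝ →L[ℝ] ℝ => M w) this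
  let L₁ : R3 →L[ℝ] ℝ := ContinuousLinearMap.fst ℝ ℝ (ℝ × ℝ)
  let L₂ : R3 →L[ℝ] ℝ :=
    (ContinuousLinearMap.fst ℝ ℝ ℝ).comp (ContinuousLinearMap.snd ℝ ℝ (ℝ × ℝ))
  let L₃ : R3 →L[ℝ] ℝ :=
    (ContinuousLinearMap.snd ℝ ℝ ℝ).comp (ContinuousLinearMap.snd ℝ ℝ (ℝ × ℝ))
  have hB : IsBlowup (comp1 ψ) (comp2 ψ) A R :=
    { pos := hR
      analytic₁ := han L₁
      analytic₂ := han L₂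
      zero₁ := fun u => congrArg Prod.fst (h0 u)
      zero₂ := fun u => congrArg (fun x : R3 => x.2.1) (h0 u)
      deriv₁ := fun u => (hfd L₁ _ (mem_strip2_zero hR u) _).trans (congrArg L₁ (hbv u))
      deriv₂ := fun u => (hfd L₂ _ (mem_strip2_zero hR u) _).trans (congrArg L₂ (hbv u))
      differentiable := fun u => (hAa u (mem_univ u)).differentiableAt
      ne_zero := hA0
      periodic₁ := fun u v => congrArg Prod.fst (hper u v)
      periodic₂ := fun u v => congrArg (fun x : R3 => x.2.1) (hper u v) }
  have hper₃ : ∀ p q : ℝ × ℝ, p.2 = q.2 → (∃ n : ℤ, p.1 - q.1 = 2 * π * n) →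
      comp3 ψ p = comp3 ψ q := by
    rintro ⟨u, v⟩ ⟨u', v'⟩ rfl ⟨n, hn⟩
    have hp : Function.Periodic (fun x => ψ (x, v)) (2 * π) := fun x => hper x v
    have := hp.int_mul n u'
    have e : u = u' + n * (2 * π) := by simp only at hn; linarith
    rw [e]
    exact congrArg (fun x : R3 => x.2.2) this
  obtain ⟨r, hr, hrR, hne, hinj⟩ := hB.exists_strip
  have hinj' : ∀ p ∈ Strip r, ∀ q ∈ Strip r, Pi2 ψ p = Pi2 ψ q →
      p.2 = q.2 ∧ ∃ n : ℤ, p.1 - q.1 = 2 * π * n := fun p hp q hq h =>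
    hinj p hp q hq (Prod.ext_iff.1 h).1 (Prod.ext_iff.1 h).2
  obtain ⟨z, hz⟩ : ∃ z : ℝ × ℝ → ℝ, ∀ p ∈ Strip r, comp3 ψ p = z (Pi2 ψ p) := by
    refine ⟨fun w => comp3 ψ (Function.invFunOn (Pi2 ψ) (Strip r) w), fun p hp => ?_⟩
    have hex : ∃ q ∈ Strip r, Pi2 ψ q = Pi2 ψ p := ⟨p, hp, rfl⟩
    obtain ⟨h1, h2⟩ := hinj' p hp _ (Function.invFunOn_mem hex) (Function.invFunOn_eq hex).symm
    exact hper₃ _ _ h1 h2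
  refine ⟨r, hr, hrR, Pi2 ψ '' Strip r, ?_,
    hB.insert_image_strip_mem_nhds hjac hr hrR hne, rfl, hinj', z, ?_, hz⟩
  · rintro ⟨p, hp, h⟩
    exact hne p hp h
  rintro _ ⟨p, hp, rfl⟩
  have hpR : p ∈ Strip R := ⟨hp.1, hp.2.trans_le hrR⟩
  have hp2 := strip_subset_strip2 le_rfl hpR
  have hgrad := fderiv_apply_of_comp_eventuallyEq
    (hB.analytic₁ p hp2).hasStrictFDerivAt (hB.analytic₂ p hp2).hasStrictFDerivAt
    (han L₃ p hp2).hasStrictFDerivAt (hjac p hpR).ne' (z := z)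
    (by filter_upwards [(isOpen_strip r).mem_nhds hp] with q hq using (hz q hq).symm)
  have ha := hgrad (1, 0)
  have hb := hgrad (0, 1)
  have hJ := hjac p hpR
  obtain ⟨hc₁, hc₂⟩ := hconf p hp2
  have hs := hsp p hpR
  have d1 := hfd L₁ p hp2
  have d2 := hfd L₂ p hp2
  have d3 := hfd L₃ p hp2
  change ∀ w, fderiv ℝ (comp1 ψ) p w = (fderiv ℝ ψ p w).1 at d1
  change ∀ w, fderiv ℝ (comp2 ψ) p w = (fderiv ℝ ψ p w).2.1 at d2
  change ∀ w, fderiv ℝ (fun q => L₃ (ψ q)) p w = (fderiv ℝ ψ p w).2.2 at d3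
  rw [ContinuousLinearMap.apply_prod_eq, d1, d2, d3] at ha hb
  simp only [pd1, pd2, d1, d2] at hJ
  exact gradient_sq_lt_one_of_spacelike hJ hc₁ hs hc₂ ha hb
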